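/- Assume there exists a p-point delayer strategy (with p ≥ 1) for a QBC Φ with respect to a semicompletion-closed axiom set H, and assume π is a tree-like QU-resolution proof of Φ from H ending with the empty clause. Then the tree G(π) has at least 2^p leaves. -/

import Mathlib

/-! Framework for quantified Boolean circuits (QBCs), QU-resolution,
relaxations, and the prover–delayer game, following Chen,
"Proof Complexity Modulo the Polynomial Hierarchy". -/

/-- Quantifiers. -/
inductive Quant where
  | all : Quant
  | ex : Quant
deriving DecidableEq

/-- A partial assignment of Boolean values to (numbered) propositional
variables.  Via the correspondence `C ↔ assign(C)`, partial assignments also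
represent clauses (the clause `clause(a)` is the unique clause with variable
set `dom a` falsified by `a`); we freely identify the two. -/
abbrev PA : Type := ℕ → Option Bool

/-- The everywhere-undefined partial assignment (= the empty clause). -/
def emptyPA : PA := fun _ => none

/-- `g` extends the partial assignment `f`. -/
def ExtendsPA (g f : PA) : Prop := ∀ v b, f v = some b → g v = some b

/-- A total assignment `g` extends a partial assignment `f`; when `f`
represents a clause, this says `g` falsifies that clause. -/
def TotalExtends (g : ℕ → Bool) (f : PA) : Prop := ∀ v b, f v = some b → g v = b

/-- A partial assignment `r` satisfies a clause `C` (i.e. makes some literal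
of `C` true). -/
def SatisfiedBy (r : PA) (C : PA) : Prop := ∃ v b, C v = some b ∧ r v = some (!b)

/-- A quantified Boolean circuit: a quantifier prefix (a list of
quantifier/variable pairs) together with a Boolean function on total
assignments, represented as a predicate. -/
structure QBC where
  pfx : List (Quant × ℕ)
  matrix : (ℕ → Bool) → Prop

/-- The variables of the prefix of a QBC. -/
def QBC.vars (Φ : QBC) : List ℕ := Φ.pfx.map Prod.snd

/-- Well-formedness of a QBC: the prefix has no repeated variables, and the
matrix depends only on the values of the prefix variables. -/
def QBC.WellFormed (Φ : QBC) : Prop :=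
  Φ.vars.Nodup ∧
  ∀ f g : ℕ → Bool, (∀ v ∈ Φ.vars, f v = g v) → (Φ.matrix f ↔ Φ.matrix g)

/-- Standard semantics of a quantifier prefix over a matrix, starting from a
base assignment. -/
def evalQ : List (Quant × ℕ) → ((ℕ → Bool) → Prop) → (ℕ → Bool) → Prop
  | [], φ, g => φ g
  | (Quant.ex, v) :: P, φ, g => ∃ b, evalQ P φ (Function.update g v b)
  | (Quant.all, v) :: P, φ, g => ∀ b, evalQ P φ (Function.update g v b)

/-- Truth of a QBC. -/
def QBC.IsTrue (Φ : QBC) : Prop := ∀ g, evalQ Φ.pfx Φ.matrix g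

/-- Falsity of a QBC. -/
def QBC.IsFalse (Φ : QBC) : Prop := ¬ Φ.IsTrue

/-- The existentially quantified variables of a prefix. -/
def existVars (P : List (Quant × ℕ)) : List ℕ :=
  (P.filter fun p => decide (p.1 = Quant.ex)).map Prod.snd

/-- The universally quantified variables of a prefix. -/
def univVars (P : List (Quant × ℕ)) : List ℕ :=
  (P.filter fun p => decide (p.1 = Quant.all)).map Prod.snd

/-- The relation `u ⪯ v` of a prefix: `vᵢ ⪯ vⱼ` iff `i ≤ j`, or `j < i` and
`Qⱼ = Qⱼ₊₁ = ⋯ = Qᵢ`. -/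
def preceq (P : List (Quant × ℕ)) (u v : ℕ) : Prop :=
  ∃ i j : ℕ, (P[i]?).map Prod.snd = some u ∧ (P[j]?).map Prod.snd = some v ∧
    (i ≤ j ∨ (j < i ∧ ∀ k, j ≤ k → k ≤ i → (P[k]?).map Prod.fst = (P[j]?).map Prod.fst))

/-- `u` strictly precedes `v` (`u ⪯ v` and not `v ⪯ u`). -/
def strictPrec (P : List (Quant × ℕ)) (u v : ℕ) : Prop :=
  preceq P u v ∧ ¬ preceq P v u

/-- dom(f) ⪯ y : every variable on which `f` is defined is `⪯ y`. -/
def domPrec (P : List (Quant × ℕ)) (f : PA) (y : ℕ) : Prop :=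
  ∀ u, f u ≠ none → preceq P u y

/-- An ∃-strategy: a family of response functions for the existential
variables, each depending only on the universal variables strictly
preceding it. -/
def IsExStrategy (Φ : QBC) (σ : ℕ → (ℕ → Bool) → Bool) : Prop :=
  ∀ x ∈ existVars Φ.pfx, ∀ τ τ' : ℕ → Bool,
    (∀ y ∈ univVars Φ.pfx, strictPrec Φ.pfx y x → τ y = τ' y) → σ x τ = σ x τ'

/-- The total assignment `⟨σ, τ⟩` induced by an ∃-strategy `σ` and an
assignment `τ` to the universal variables. -/
def playE (Φ : QBC) (σ : ℕ → (ℕ → Bool) → Bool) (τ : ℕ → Bool) : ℕ → Bool :=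
  fun v => if v ∈ existVars Φ.pfx then σ v τ else τ v

/-- `σ` is a winning ∃-strategy of the prefix of `Φ` for the matrix `M`. -/
def ModelOf (Φ : QBC) (M : (ℕ → Bool) → Prop) (σ : ℕ → (ℕ → Bool) → Bool) : Prop :=
  IsExStrategy Φ σ ∧ ∀ τ : ℕ → Bool, M (playE Φ σ τ)

/-- A model of `Φ` (a winning ∃-strategy). -/
def QBC.Model (Φ : QBC) (σ : ℕ → (ℕ → Bool) → Bool) : Prop :=
  ModelOf Φ Φ.matrix σ

/-- `σ` is a model of `P : C`, where `P` is the prefix of `Φ` and `C` is a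
clause (represented by its falsifying assignment). -/
def ModelOfClause (Φ : QBC) (σ : ℕ → (ℕ → Bool) → Bool) (C : PA) : Prop :=
  ModelOf Φ (fun g => ¬ TotalExtends g C) σ

/-- `C` is an axiom of `Φ`: a clause on the variables of `Φ` such that every
model of `Φ` is a model of `P : C`. -/
def IsAxiom (Φ : QBC) (C : PA) : Prop :=
  (∀ v, C v ≠ none → v ∈ Φ.vars) ∧ ∀ σ, Φ.Model σ → ModelOfClause Φ σ C

/-- An axiom set of `Φ`. -/
def IsAxiomSet (Φ : QBC) (H : Set PA) : Prop := ∀ C ∈ H, IsAxiom Φ C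

/-- A ∀-strategy: response functions for the universal variables, each
depending only on the existential variables strictly preceding it. -/
def IsUnivStrategy (Φ : QBC) (τ : ℕ → (ℕ → Bool) → Bool) : Prop :=
  ∀ y ∈ univVars Φ.pfx, ∀ σ σ' : ℕ → Bool,
    (∀ x ∈ existVars Φ.pfx, strictPrec Φ.pfx x y → σ x = σ' x) → τ y σ = τ y σ'

/-- The total assignment `⟨τ, σ⟩` induced by a ∀-strategy `τ` and an
assignment `σ` to the existential variables. -/
def playU (Φ : QBC) (τ : ℕ → (ℕ → Bool) → Bool) (σ : ℕ → Bool) : ℕ → Bool :=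
  fun v => if v ∈ univVars Φ.pfx then τ v σ else σ v

/-- A winning ∀-strategy: every play falsifies the matrix. -/
def WinningUnivStrategy (Φ : QBC) (τ : ℕ → (ℕ → Bool) → Bool) : Prop :=
  IsUnivStrategy Φ τ ∧ ∀ σ : ℕ → Bool, ¬ Φ.matrix (playU Φ τ σ)

/-- `C` is obtainable from `D` by ∀-elimination (relative to prefix `P`):
`C = D ∖ {L}` for a literal `L` on a universal variable `y` with
`vars(C) ⪯ y`.  In assignment form: `D` is `C` additionally defined on `y`. -/
def ForallElim (P : List (Quant × ℕ)) (C D : PA) : Prop :=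
  ∃ y b, y ∈ univVars P ∧ C y = none ∧ D = Function.update C y (some b) ∧
    ∀ u, C u ≠ none → preceq P u y

/-- `γ` is the resolvent of `α` and `β` on variable `v` (in falsifying
assignment form: `α` and `β` carry complementary literals on `v`, `γ` is
the union of the remainders, which must be a clause). -/
def IsResolvent (γ α β : PA) (v : ℕ) : Prop :=
  ∃ b, α v = some b ∧ β v = some (!b) ∧ γ v = none ∧
    (∀ u, u ≠ v → γ u = (α u).elim (β u) some) ∧
    (∀ u, u ≠ v → ∀ b₁ b₂, α u = some b₁ → β u = some b₂ → b₁ = b₂)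

/-- A step in a QU-resolution proof: an axiom, a ∀-elimination (annotated with
the index of its source), or a resolution step (annotated with the indices of
its two sources and the resolved variable). -/
inductive QUStep where
  | ax (C : PA)
  | elim (C : PA) (src : ℕ)
  | res (C : PA) (src₁ src₂ : ℕ) (v : ℕ)

/-- The clause of a proof step. -/
def QUStep.clause : QUStep → PA
  | .ax C => C
  | .elim C _ => C
  | .res C _ _ _ => C

/-- The clause at position `i` of a proof. -/
def stepClause? (L : List QUStep) (i : ℕ) : Option PA := (L[i]?).map QUStep.clause

/-- Validity of the `i`-th step of a proof from axiom set `H`. -/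
def validStep (P : List (Quant × ℕ)) (H : Set PA) (L : List QUStep) (i : ℕ) : Prop :=
  match L[i]? with
  | none => True
  | some (.ax C) => C ∈ H
  | some (.elim C j) => j < i ∧ ∃ D, stepClause? L j = some D ∧ ForallElim P C D
  | some (.res C j k v) => j < i ∧ k < i ∧
      ∃ α β, stepClause? L j = some α ∧ stepClause? L k = some β ∧ IsResolvent C α β v

/-- A QU-resolution proof of `Φ` from axiom set `H`. -/
def IsQUProof (Φ : QBC) (H : Set PA) (L : List QUStep) : Prop :=
  ∀ i, validStep Φ.pfx H L i

/-- A QU-resolution falsity proof: a proof ending with the empty clause. -/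
def IsFalsityProof (Φ : QBC) (H : Set PA) (L : List QUStep) : Prop :=
  IsQUProof Φ H L ∧ (L.getLast?).map QUStep.clause = some emptyPA

/-- The clause `C` appears in the proof `L`. -/
def AppearsIn (L : List QUStep) (C : PA) : Prop := ∃ i, stepClause? L i = some C

/-- The edge relation of the graph `G(π)`: an edge from each clause occurrence
to the clause occurrence(s) from which it is derived. -/
def edge (L : List QUStep) (i j : ℕ) : Prop :=
  match L[i]? with
  | some (.elim _ s) => j = s
  | some (.res _ s t _) => j = s ∨ j = t
  | _ => False

/-- A sink (leaf) of `G(π)`: a vertex with no outgoing edges. -/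
def isSink (L : List QUStep) (i : ℕ) : Prop := i < L.length ∧ ∀ j, ¬ edge L i j

/-- The proof is tree-like: `G(π)` is a tree (each vertex has at most one
incoming edge; acyclicity holds automatically since edges decrease indices). -/
def TreeLike (L : List QUStep) : Prop := ∀ j : ℕ, {i | edge L i j}.Subsingleton

-- The prefix `P[a]`: the variables of `dom a` are removed, and the
-- quantifier of every variable strictly preceding some variable of `dom a`
-- (equivalently, every `v` with `v ⪯ last(a)` and not `last(a) ⪯ v`) is
-- changed to `∃`.
open Classical in
noncomputable def instPrefix (P : List (Quant × ℕ)) (a : PA) : List (Quant × ℕ) :=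
  (P.filter fun p => (a p.2).isNone).map fun p =>
    (if ∃ u, a u ≠ none ∧ strictPrec P p.2 u then Quant.ex else p.1, p.2)

/-- Overriding a total assignment by a partial assignment. -/
def override (a : PA) (g : ℕ → Bool) : ℕ → Bool := fun v => (a v).getD (g v)

/-- The instantiated QBC `Φ[a]` = `P[a] : φ[a]`. -/
noncomputable def QBC.inst (Φ : QBC) (a : PA) : QBC :=
  ⟨instPrefix Φ.pfx a, fun g => Φ.matrix (override a g)⟩

/-- `P'` is a relaxation of the prefix `P`: a permutation of `P` such that
`y ⪯ x` implies `y ⪯' x` for every universal `y` and existential `x`. -/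
def IsRelaxationPfx (P P' : List (Quant × ℕ)) : Prop :=
  P.Perm P' ∧ ∀ y ∈ univVars P, ∀ x ∈ existVars P, preceq P y x → preceq P' y x

/-- `Φ'` is a relaxation of the QBC `Φ`. -/
def IsRelaxation (Φ Φ' : QBC) : Prop :=
  IsRelaxationPfx Φ.pfx Φ'.pfx ∧ Φ'.matrix = Φ.matrix

/-- Negation of a quantifier. -/
def Quant.neg : Quant → Quant
  | .all => .ex
  | .ex => .all

/-- `isAltFrom q i qs`: the quantifier string `qs` consists of (at most) `i`
alternating possibly-empty blocks, starting with a block of `q`s. -/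
def isAltFrom : Quant → ℕ → List Quant → Prop
  | _, 0, qs => qs = []
  | q, i + 1, qs => ∃ k rest, qs = List.replicate k q ++ rest ∧ isAltFrom q.neg i rest

/-- The prefix `P` is `Π_i`: its quantifier string lies in `∀*∃*∀*⋯` with `i`
alternating starred blocks beginning with `∀*`. -/
def isPiPrefix (i : ℕ) (P : List (Quant × ℕ)) : Prop :=
  isAltFrom Quant.all i (P.map Prod.fst)

/-- The axiom set `H(Φ, Π_k)`: the clauses `C` on variables of `Φ` such that
some `Π_k`-relaxation of `Φ[assign(C)]` is false. -/
def Hset (Φ : QBC) (k : ℕ) : Set PA :=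
  {C | (∀ v, C v ≠ none → v ∈ Φ.vars) ∧
    ∃ Φ' : QBC, IsRelaxation (Φ.inst C) Φ' ∧ isPiPrefix k Φ'.pfx ∧ Φ'.IsFalse}

/-- `g` is a semicompletion of `f` (relative to prefix `P`). -/
def SemiComp (P : List (Quant × ℕ)) (f g : PA) : Prop :=
  ExtendsPA g f ∧
  ∀ y ∈ univVars P, f y = none → domPrec P f y → (g y = none ∧ domPrec P g y)

/-- A set of partial assignments of `Φ` is semicompletion-closed. -/
def SemiCompClosed (Φ : QBC) (H : Set PA) : Prop :=
  ∀ f ∈ H, ∀ g : PA, (∀ v, g v ≠ none → v ∈ Φ.vars) → SemiComp Φ.pfx f g → g ∈ H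

/-- Delayer condition (semicompletion-of-empty). -/
def CondEmpty (Φ : QBC) (F : Set PA) (s : PA → ℕ) : Prop :=
  ∃ g ∈ F, SemiComp Φ.pfx emptyPA g ∧ s g = 0

/-- Delayer condition (monotonicity). -/
def CondMono (Φ : QBC) (F : Set PA) (s : PA → ℕ) : Prop :=
  ∀ g ∈ F, ∀ f' : PA, ExtendsPA g f' → ∃ f ∈ F, SemiComp Φ.pfx f' f ∧ s f ≤ s g

/-- Delayer condition (∀-branching). -/
def CondForallB (Φ : QBC) (F : Set PA) (s : PA → ℕ) : Prop :=
  ∀ f ∈ F, ∀ y ∈ univVars Φ.pfx, f y = none → domPrec Φ.pfx f y →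
    ∀ b : Bool, ∃ g ∈ F, SemiComp Φ.pfx (Function.update f y (some b)) g ∧ s g = s f

/-- Delayer condition (double-branching). -/
def CondDoubleB (Φ : QBC) (F : Set PA) (s : PA → ℕ) : Prop :=
  ∀ f ∈ F, ∀ v ∈ Φ.vars, f v = none →
    ∃ b : Bool, ∃ g ∈ F, SemiComp Φ.pfx (Function.update f v (some b)) g ∧
      s g ≤ s f + 1 ∧
      (s g = s f + 1 →
        ∃ g' ∈ F, SemiComp Φ.pfx (Function.update f v (some (!b))) g' ∧ s g' ≤ s f + 1)

/-- A `p`-point delayer strategy for `Φ` with respect to axiom set `H`. -/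
def IsDelayer (Φ : QBC) (H : Set PA) (p : ℕ) (F : Set PA) (s : PA → ℕ) : Prop :=
  (∀ f ∈ F, ∀ v, f v ≠ none → v ∈ Φ.vars) ∧
  CondEmpty Φ F s ∧ (∀ f ∈ F, f ∈ H → p ≤ s f) ∧
  CondMono Φ F s ∧ CondForallB Φ F s ∧ CondDoubleB Φ F s

/-! The separation formulas `Φₙ` of Section 6. -/

/-- The variable `x_{i,j,k}`. -/
def xV (i : ℕ) (j k : Bool) : ℕ := 9 * i + 2 * cond j 1 0 + cond k 1 0

/-- The variable `x'_{i,j,k}`. -/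
def xV' (i : ℕ) (j k : Bool) : ℕ := 9 * i + 4 + 2 * cond j 1 0 + cond k 1 0

/-- The variable `yᵢ`. -/
def yV (i : ℕ) : ℕ := 9 * i + 8

/-- A block of four quantified variables. -/
def blockOf (q : Quant) (f : Bool → Bool → ℕ) : List (Quant × ℕ) :=
  [(q, f false false), (q, f false true), (q, f true false), (q, f true true)]

/-- The prefix `∃X₀ ∃X'₁∀y₁∃X₁ ⋯ ∃X'ₙ∀yₙ∃Xₙ`. -/
def sepPrefix (n : ℕ) : List (Quant × ℕ) :=
  blockOf Quant.ex (xV 0) ++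
    (List.range n).flatMap fun i =>
      blockOf Quant.ex (xV' (i + 1)) ++ [(Quant.all, yV (i + 1))] ++
        blockOf Quant.ex (xV (i + 1))

/-- The clause `¬x_{0,j,k}` (as its falsifying assignment). -/
def clB1 (j k : Bool) : PA := fun v => if v = xV 0 j k then some true else none

/-- The clause `x_{n,j,0} ∨ x_{n,j,1}`. -/
def clB2 (n : ℕ) (j : Bool) : PA :=
  fun v => if v = xV n j false ∨ v = xV n j true then some false else none

/-- The clause `¬x'_{i,0,k} ∨ ¬x'_{i,1,l} ∨ x_{i−1,j,0} ∨ x_{i−1,j,1}`. -/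
def clH (i : ℕ) (j k l : Bool) : PA := fun v =>
  if v = xV' i false k ∨ v = xV' i true l then some true
  else if v = xV (i - 1) j false ∨ v = xV (i - 1) j true then some false
  else none

/-- For `j = false` the clause `¬x_{i,0,k} ∨ yᵢ ∨ x'_{i,0,k}`; for `j = true`
the clause `¬x_{i,1,k} ∨ ¬yᵢ ∨ x'_{i,1,k}`. -/
def clT (i : ℕ) (j k : Bool) : PA := fun v =>
  if v = xV i j k then some true
  else if v = yV i then some j
  else if v = xV' i j k then some false
  else none

/-- The set `Tᵢ` of clauses. -/
def Tset (i : ℕ) : Set PA := {C | ∃ j k : Bool, C = clT i j k}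

/-- The set of clauses of the matrix `φₙ`. -/
def sepClauses (n : ℕ) : Set PA :=
  {C | (∃ j k : Bool, C = clB1 j k) ∨ (∃ j : Bool, C = clB2 n j) ∨
    (∃ i, 1 ≤ i ∧ i ≤ n ∧ ∃ j k l : Bool, C = clH i j k l) ∨
    (∃ i, 1 ≤ i ∧ i ≤ n ∧ ∃ j k : Bool, C = clT i j k)}

/-- The separation formula `Φₙ`. -/
def sepQBC (n : ℕ) : QBC :=
  ⟨sepPrefix n, fun g => ∀ C ∈ sepClauses n, ¬ TotalExtends g C⟩

/-- The level-`i` variables `X'ᵢ ∪ {yᵢ} ∪ Xᵢ`. -/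
def levelVars (i : ℕ) : List ℕ :=
  [xV' i false false, xV' i false true, xV' i true false, xV' i true true, yV i,
   xV i false false, xV i false true, xV i true false, xV i true true]

/-- `r` is defined exactly on the level-`i` variables. -/
def OnLevel (i : ℕ) (r : PA) : Prop := ∀ v, r v ≠ none ↔ v ∈ levelVars i

/-- A normal realization of level `i`. -/
def NormalReal (i : ℕ) (r : PA) : Prop :=
  OnLevel i r ∧ ∃ b : Bool, r (yV i) = some b ∧
    r (xV i b false) = some false ∧ r (xV' i b false) = some false ∧
    r (xV i b true) = some false ∧ r (xV' i b true) = some false ∧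
    ∃ c : Bool, r (xV i (!b) false) = some c ∧ r (xV' i (!b) false) = some c ∧
      r (xV i (!b) true) = some (!c) ∧ r (xV' i (!b) true) = some (!c)

/-- A funny realization of level `i`. -/
def FunnyReal (i : ℕ) (r : PA) : Prop :=
  OnLevel i r ∧ ∃ b : Bool, r (yV i) = some b ∧
    (∃ c : Bool, r (xV i b false) = some c ∧ r (xV' i b false) = some c ∧
      r (xV i b true) = some (!c) ∧ r (xV' i b true) = some (!c)) ∧
    r (xV' i (!b) false) = some false ∧ r (xV' i (!b) true) = some false ∧
    ∃ d : Bool, r (xV i (!b) false) = some d ∧ r (xV i (!b) true) = some (!d)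

/-- Restriction of a partial assignment to the level-`i` variables. -/
def restrictLevel (i : ℕ) (f : PA) : PA :=
  fun v => if v ∈ levelVars i then f v else none

-- The maximum level `ℓ` containing an existentially quantified variable of
-- `dom f` (and `0` if there is none).
open Classical in
noncomputable def maxLevel (n : ℕ) (f : PA) : ℕ :=
  ((Finset.Icc 1 n).filter fun i => ∃ v ∈ levelVars i, v ≠ yV i ∧ f v ≠ none).sup id

/-- `f` is half-defined on level `ℓ`. -/
def HalfDefined (ℓ : ℕ) (f : PA) : Prop :=
  (∀ j k : Bool, f (xV ℓ j k) = none) ∧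
  (∃ j k : Bool, f (xV' ℓ j k) = some true ∧
    ∀ j' k' : Bool, (j', k') ≠ (j, k) → f (xV' ℓ j' k') = some false)

/-- A normal assignment of `Φₙ`. -/
def NormalAssign (n : ℕ) (f : PA) : Prop :=
  (∀ v, f v ≠ none → v ∈ (sepPrefix n).map Prod.snd) ∧
  (∀ j k : Bool, f (xV 0 j k) = some false) ∧
  (∀ i, 1 ≤ i → i + 1 ≤ maxLevel n f → NormalReal i (restrictLevel i f)) ∧
  (1 ≤ maxLevel n f →
    (NormalReal (maxLevel n f) (restrictLevel (maxLevel n f) f) ∨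
      HalfDefined (maxLevel n f) f))

/-- A funny assignment of `Φₙ`, with witness `m` (so that `sₙ(f) = m`). -/
def FunnyAssign (n : ℕ) (f : PA) (m : ℕ) : Prop :=
  (∀ v, f v ≠ none → v ∈ (sepPrefix n).map Prod.snd) ∧
  1 ≤ m ∧ m ≤ maxLevel n f ∧
  (∀ j k : Bool, f (xV 0 j k) = some false) ∧
  (∀ i, 1 ≤ i → i < m → NormalReal i (restrictLevel i f)) ∧
  FunnyReal m (restrictLevel m f) ∧
  (∀ i, m < i → i ≤ maxLevel n f → ∀ j : Bool,
    ((f (xV i j false) ≠ none ∨ f (xV i j true) ≠ none ∨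
      f (xV' i j false) ≠ none ∨ f (xV' i j true) ≠ none) →
      ∃ c : Bool, f (xV i j false) = some c ∧ f (xV' i j false) = some c ∧
        f (xV i j true) = some (!c) ∧ f (xV' i j true) = some (!c)))

/-- The set `Fₙ` of normal and funny assignments. -/
def Fset (n : ℕ) : Set PA := {f | NormalAssign n f ∨ ∃ m, FunnyAssign n f m}

-- The score function `sₙ`.
open Classical in
noncomputable def score (n : ℕ) (f : PA) : ℕ :=
  if h : ∃ m, FunnyAssign n f m then h.choose else maxLevel n f

/-! The mod-3 formulas `Ψₙ` of Section 7 (variables `xᵢ = 2i`, `yᵢ = 2i+1`). -/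

/-- The prefix `∃x₁∀y₁⋯∃xₙ∀yₙ`. -/
def modPrefix (n : ℕ) : List (Quant × ℕ) :=
  (List.range n).flatMap fun i =>
    [(Quant.ex, 2 * (i + 1)), (Quant.all, 2 * (i + 1) + 1)]

/-- Numeric value of a Boolean. -/
def boolVal (b : Bool) : ℕ := cond b 1 0

/-- The matrix `φ_{n,j}`: true iff `j + Σᵢ (xᵢ + yᵢ) ≢ n (mod 3)`. -/
def modMatrix (n j : ℕ) (g : ℕ → Bool) : Prop :=
  ¬ ((j + ∑ i ∈ Finset.Icc 1 n, (boolVal (g (2 * i)) + boolVal (g (2 * i + 1)))) % 3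
      = n % 3)

/-- The mod-3 formula `Ψₙ`. -/
def modQBC (n : ℕ) : QBC := ⟨modPrefix n, modMatrix n 0⟩

/-- The leaves reachable from vertex `i`. -/
def leavesFrom (L : List QUStep) (i : ℕ) : Set ℕ :=
  {l | isSink L l ∧ Relation.ReflTransGen (edge L) i l}

lemma leavesFrom_finite (L : List QUStep) (i : ℕ) : (leavesFrom L i).Finite :=
  (Set.finite_lt_nat L.length).subset fun _ hl => hl.1.1

lemma leavesFrom_sub (L : List QUStep) (i j : ℕ) (h : edge L i j) :
    leavesFrom L j ⊆ leavesFrom L i :=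
  fun _ hl => ⟨hl.1, Relation.ReflTransGen.head h hl.2⟩

lemma edge_lt {Φ : QBC} {H : Set PA} {L : List QUStep} (hL : IsQUProof Φ H L) {i j : ℕ}
    (h : edge L i j) : j < i := by
  have hv := hL i
  unfold validStep at hv
  unfold edge at h
  rcases hi : L[i]? with _ | (C | ⟨C, a⟩ | ⟨C, a, b, v⟩)
  · simp [hi] at h
  · simp [hi] at h
  · simp only [hi] at h hv
    have := hv.1
    omega
  · simp only [hi] at h hv
    have := hv.1
    have := hv.2.1
    omega

lemma reach_le {Φ : QBC} {H : Set PA} {L : List QUStep} (hL : IsQUProof Φ H L) {i j : ℕ}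
    (h : Relation.ReflTransGen (edge L) i j) : j ≤ i := by
  induction h with
  | refl => exact le_rfl
  | tail _ h ih => exact (edge_lt hL h).le.trans ih

lemma no_reach {Φ : QBC} {H : Set PA} {L : List QUStep} (hL : IsQUProof Φ H L)
    (htree : TreeLike L) {i j k : ℕ} (hj : edge L i j) (hk : edge L i k) (hne : j ≠ k)
    (h : Relation.ReflTransGen (edge L) j k) : False := by
  rcases Relation.ReflTransGen.cases_tail h with h | ⟨c, hc, hck⟩
  · exact hne h.symm
  · have : c = i := htree k hck hk
    subst this
    have h1 := reach_le hL hc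
    have h2 := edge_lt hL hj
    omega

lemma leavesFrom_disj {Φ : QBC} {H : Set PA} {L : List QUStep} (hL : IsQUProof Φ H L)
    (htree : TreeLike L) {i j k : ℕ} (hj : edge L i j) (hk : edge L i k) (hne : j ≠ k) :
    Disjoint (leavesFrom L j) (leavesFrom L k) := by
  rw [Set.disjoint_left]
  intro l hl hl'
  have h1 := Relation.reflTransGen_swap.2 hl.2
  have h2 := Relation.reflTransGen_swap.2 hl'.2
  have U : Relator.RightUnique (Function.swap (edge L)) := fun a b c hb hc => htree a hb hc
  rcases Relation.ReflTransGen.total_of_right_unique U h1 h2 with h | h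
  · exact no_reach hL htree hk hj hne.symm (Relation.reflTransGen_swap.1 h)
  · exact no_reach hL htree hj hk hne (Relation.reflTransGen_swap.1 h)

lemma clause_vars {Φ : QBC} {H : Set PA} (hH : IsAxiomSet Φ H) {L : List QUStep}
    (hL : IsQUProof Φ H L) (i : ℕ) :
    ∀ C, stepClause? L i = some C → ∀ v, C v ≠ none → v ∈ Φ.vars := by
  induction i using Nat.strong_induction_on with
  | _ i ih =>
    intro C hC v hv
    have hV := hL i
    unfold validStep at hV
    unfold stepClause? at hC
    rcases hi : L[i]? with _ | (C' | ⟨C', a⟩ | ⟨C', a, b, w⟩)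
    · simp [hi] at hC
    · simp only [hi, Option.map_some, QUStep.clause, Option.some.injEq] at hC hV
      subst hC
      exact (hH _ hV).1 v hv
    · simp only [hi, Option.map_some, QUStep.clause, Option.some.injEq] at hC hV
      subst hC
      obtain ⟨ha, D, hD, y, b, hy, hCy, rfl, -⟩ := hV
      refine ih a ha _ hD v ?_
      by_cases hvy : v = y
      · subst hvy; simp
      · simpa [hvy] using hv
    · simp only [hi, Option.map_some, QUStep.clause, Option.some.injEq] at hC hV
      subst hC
      obtain ⟨ha, hb, α, β, hα, hβ, c, h1, h2, h3, h4, h5⟩ := hV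
      have hvw : v ≠ w := by rintro rfl; exact hv h3
      rw [h4 v hvw] at hv
      rcases hαv : α v with _ | d
      · rw [hαv] at hv
        exact ih b hb _ hβ v hv
      · exact ih a ha _ hα v (by simp [hαv])

lemma res_ext {γ α β : PA} {w : ℕ} (h : IsResolvent γ α β w) {f : PA} (hf : ExtendsPA f γ) :
    (f w = α w → ExtendsPA f α) ∧ (f w = β w → ExtendsPA f β) := by
  obtain ⟨c, h1, h2, h3, h4, h5⟩ := h
  constructor
  · intro e u b hb
    by_cases huw : u = w
    · subst huw; rw [e, hb]
    · apply hf; rw [h4 u huw, hb]; rfl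
  · intro e u b hb
    by_cases huw : u = w
    · subst huw; rw [e, hb]
    · apply hf; rw [h4 u huw]
      rcases hαu : α u with _ | d
      · simpa using hb
      · simpa using h5 u huw d b hαu hb

lemma extends_of_update {f g : PA} {w : ℕ} {b : Bool} {γ : PA} (hf : ExtendsPA f γ)
    (hw : f w = none) (hg : ExtendsPA g (Function.update f w (some b))) :
    ExtendsPA g γ ∧ g w = some b := by
  refine ⟨fun u d hd => hg u d ?_, hg w b (by simp)⟩
  have := hf u d hd
  have huw : u ≠ w := by rintro rfl; simp [hw] at this
  simpa [huw] using this

lemma main_count {Φ : QBC} {H : Set PA} (hH : IsAxiomSet Φ H) (hsc : SemiCompClosed Φ H)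
    {p : ℕ} {F : Set PA} {s : PA → ℕ} (hd : IsDelayer Φ H p F s)
    {L : List QUStep} (hL : IsQUProof Φ H L) (htree : TreeLike L) (i : ℕ) :
    ∀ C, stepClause? L i = some C → ∀ f ∈ F, SemiComp Φ.pfx C f →
      2 ^ (p - s f) ≤ (leavesFrom L i).ncard := by
  obtain ⟨hFv, -, hpts, hmono, hall, hdbl⟩ := hd
  induction i using Nat.strong_induction_on with
  | _ i ih =>
    intro C hC f hf hCf
    have hV := hL i
    have hvars := clause_vars hH hL
    unfold validStep at hV
    unfold stepClause? at hC
    rcases hi : L[i]? with _ | (C' | ⟨C', a⟩ | ⟨C', a, b, w⟩)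
    · simp [hi] at hC
    · simp only [hi, Option.map_some, QUStep.clause, Option.some.injEq] at hC hV
      subst hC
      have hfH := hsc _ hV f (hFv f hf) hCf
      have := hpts f hf hfH
      rw [Nat.sub_eq_zero_of_le this, pow_zero]
      have hmem : i ∈ leavesFrom L i := by
        refine ⟨⟨?_, fun j hj => ?_⟩, Relation.ReflTransGen.refl⟩
        · exact (List.getElem?_eq_some_iff.1 hi).1
        · simp [edge, hi] at hj
      exact Nat.succ_le_of_lt ((Set.ncard_pos (leavesFrom_finite L i)).2 ⟨i, hmem⟩)
    · simp only [hi, Option.map_some, QUStep.clause, Option.some.injEq] at hC hV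
      subst hC
      obtain ⟨ha, D, hD, y, b, hy, hCy, rfl, hprec⟩ := hV
      obtain ⟨hfy, hfp⟩ := hCf.2 y hy hCy hprec
      obtain ⟨g, hg, hfg, hsg⟩ := hall f hf y hy hfy hfp b
      have hsemi : SemiComp Φ.pfx (Function.update C' y (some b)) g := by
        constructor
        · intro u d hu
          apply hfg.1
          by_cases huy : u = y
          · subst huy; simpa using hu
          · simp only [Function.update_of_ne huy] at hu ⊢
            exact hCf.1 u d hu
        · intro z hz hzn hzp
          have hzy : z ≠ y := by rintro rfl; simp at hzn
          rw [Function.update_of_ne hzy] at hzn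
          obtain ⟨q1, q2⟩ := hCf.2 z hz hzn (fun u hu => hzp u (by
            by_cases huy : u = y
            · subst huy; simp
            · simpa [huy] using hu))
          refine hfg.2 z hz (by simpa [hzy] using q1) (fun u hu => ?_)
          by_cases huy : u = y
          · exact hzp u (by subst huy; simp)
          · exact q2 u (by simpa [huy] using hu)
      have h1 := ih a ha _ hD g hg hsemi
      rw [hsg] at h1
      exact h1.trans (Set.ncard_le_ncard (leavesFrom_sub L i a (by simp [edge, hi]))
        (leavesFrom_finite L i))
    · simp only [hi, Option.map_some, QUStep.clause, Option.some.injEq] at hC hV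
      subst hC
      obtain ⟨ha, hb, α, β, hα, hβ, hres⟩ := hV
      have hea : edge L i a := by simp [edge, hi]
      have heb : edge L i b := by simp [edge, hi]
      have hsa := Set.ncard_le_ncard (leavesFrom_sub L i a hea) (leavesFrom_finite L i)
      have hsb := Set.ncard_le_ncard (leavesFrom_sub L i b heb) (leavesFrom_finite L i)
      have key : ∀ g ∈ F, ∀ t, s g ≤ t →
          (ExtendsPA g α → 2 ^ (p - t) ≤ (leavesFrom L a).ncard) ∧
          (ExtendsPA g β → 2 ^ (p - t) ≤ (leavesFrom L b).ncard) := by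
        intro g hg t ht
        constructor
        · intro hx
          obtain ⟨h, hh, hs, hle⟩ := hmono g hg α hx
          exact (Nat.pow_le_pow_right (by norm_num) (by omega)).trans (ih a ha α hα h hh hs)
        · intro hx
          obtain ⟨h, hh, hs, hle⟩ := hmono g hg β hx
          exact (Nat.pow_le_pow_right (by norm_num) (by omega)).trans (ih b hb β hβ h hh hs)
      obtain ⟨c, h1, h2, h3, -, -⟩ := id hres
      -- a single extension of the resolvent that is defined on `w`
      have one : ∀ g ∈ F, ExtendsPA g C' → g w ≠ none → ∀ t, s g ≤ t →
          2 ^ (p - t) ≤ (leavesFrom L i).ncard := by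
        intro g hg hx hgw t ht
        obtain ⟨d, hd'⟩ := Option.ne_none_iff_exists'.1 hgw
        by_cases hdc : d = c
        · exact ((key g hg t ht).1 ((res_ext hres hx).1 (by rw [hd', h1, hdc]))).trans hsa
        · have : d = !c := by cases d <;> cases c <;> simp_all
          exact ((key g hg t ht).2 ((res_ext hres hx).2 (by rw [hd', h2, this]))).trans hsb
      by_cases hfw : f w = none
      · have hw : w ∈ Φ.vars := hvars a α hα w (by simp [h1])
        obtain ⟨d, g, hg, hfg, hle, himp⟩ := hdbl f hf w hw hfw
        obtain ⟨e1, e2⟩ := extends_of_update hCf.1 hfw hfg.1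
        by_cases hs : s g ≤ s f
        · exact one g hg e1 (by simp [e2]) _ hs
        · obtain ⟨g', hg', hfg', hle'⟩ := himp (by omega)
          obtain ⟨e1', e2'⟩ := extends_of_update hCf.1 hfw hfg'.1
          have hab : a ≠ b := by
            rintro rfl
            rw [hα] at hβ
            cases hβ
            rw [h1] at h2
            cases c <;> simp at h2
          have both : 2 ^ (p - (s f + 1)) ≤ (leavesFrom L a).ncard ∧
              2 ^ (p - (s f + 1)) ≤ (leavesFrom L b).ncard := by
            by_cases hdc : d = c
            · exact ⟨(key g hg _ hle).1 ((res_ext hres e1).1 (by rw [e2, h1, hdc])),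
                (key g' hg' _ hle').2 ((res_ext hres e1').2 (by rw [e2', h2, hdc]))⟩
            · have hdc' : d = !c := by cases d <;> cases c <;> simp_all
              exact ⟨(key g' hg' _ hle').1 ((res_ext hres e1').1 (by rw [e2', h1, hdc']; simp)),
                (key g hg _ hle).2 ((res_ext hres e1).2 (by rw [e2, h2, hdc']))⟩
          have hun := Set.ncard_union_eq (leavesFrom_disj hL htree hea heb hab)
            (leavesFrom_finite L a) (leavesFrom_finite L b)
          have hsub := Set.ncard_le_ncard (Set.union_subset (leavesFrom_sub L i a hea)
            (leavesFrom_sub L i b heb)) (leavesFrom_finite L i)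
          have hpow : 2 ^ (p - s f) ≤ 2 * 2 ^ (p - (s f + 1)) := by
            rw [← pow_succ']
            exact Nat.pow_le_pow_right (by norm_num) (by omega)
          omega
      · exact one f hf hCf.1 hfw _ le_rfl

/-- Theorem 5.2: if there is a `p`-point delayer strategy
(`p ≥ 1`) for a QBC `Φ` with respect to a semicompletion-closed axiom set `H`,
then every tree-like QU-resolution proof of `Φ` from `H` ending with the empty
clause has at least `2^p` leaves. -/
theorem delayer_many_leaves (Φ : QBC) (hΦ : Φ.WellFormed) (H : Set PA)
    (hH : IsAxiomSet Φ H) (hsc : SemiCompClosed Φ H) (p : ℕ) (hp : 1 ≤ p)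
    (F : Set PA) (s : PA → ℕ) (hd : IsDelayer Φ H p F s)
    (L : List QUStep) (hL : IsQUProof Φ H L) (htree : TreeLike L)
    (hlast : (L.getLast?).map QUStep.clause = some emptyPA) :
    2 ^ p ≤ {i | isSink L i}.ncard := by
  obtain ⟨g, hg, hsemi, hs⟩ := hd.2.1
  have hc : stepClause? L (L.length - 1) = some emptyPA := by
    rw [stepClause?, ← List.getLast?_eq_getElem?]
    exact hlast
  have h := main_count hH hsc hd hL htree (L.length - 1) _ hc g hg hsemi
  rw [hs, Nat.sub_zero] at h
  refine h.trans (Set.ncard_le_ncard (fun l hl => hl.1) ?_)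
  exact (Set.finite_lt_nat L.length).subset fun _ hl => hl.1
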